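/- arXiv:1809.06421 — 6 statements merged into one kernel-verified Lean document; each statement's English description precedes it below -/
import Mathlib

section
/- Let V_1, …, V_N : ℝ → ℝ be differentiable, let c_1, …, c_N ≥ 0, and set F = Σ_j c_j. Suppose the contributions form an equilibrium of the private contributions mechanism: for each i, c_i maximizes c ↦ V_i(c + Σ_{j ≠ i} c_j) − c over c ≥ 0. If some citizen i has c_i > 0, every citizen k satisfies V_k'(F) ≥ 0, and some citizen j ≠ i satisfies V_j'(F) > 0, then Σ_k V_k'(F) > 1; that is, the private contributions mechanism is suboptimal, leaving the total marginal value of the good strictly above its marginal cost. -/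
open Finset

/-- Suboptimality of the private contributions mechanism: at an equilibrium of the private
contributions mechanism with funding level `F = ∑ j, c j`, if some citizen `i` contributes
`c i > 0`, every citizen has nonnegative marginal value at `F`, and some other citizen `j ≠ i`
has strictly positive marginal value at `F`, then the aggregate marginal value strictly
exceeds the marginal cost: `∑ k, (V k)' F > 1`. -/
theorem private_contributions_suboptimal (N : ℕ) (V : Fin N → ℝ → ℝ)
    (hV : ∀ i, Differentiable ℝ (V i)) (c : Fin N → ℝ) (hc : ∀ i, 0 ≤ c i)
    (F : ℝ) (hF : F = ∑ j, c j)
    (heq : ∀ i, IsMaxOn (fun x : ℝ => V i (x + ∑ j ∈ univ.erase i, c j) - x)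
      {x : ℝ | 0 ≤ x} (c i))
    (i : Fin N) (hi : 0 < c i)
    (hnonneg : ∀ k, 0 ≤ deriv (V k) F)
    (j : Fin N) (hij : j ≠ i) (hj : 0 < deriv (V j) F) :
    1 < ∑ k, deriv (V k) F := by
  have hsum : c i + ∑ j ∈ univ.erase i, c j = F := by
    rw [hF]; exact Finset.add_sum_erase univ c (mem_univ i)
  have hloc : IsLocalMax (fun x : ℝ => V i (x + ∑ j ∈ univ.erase i, c j) - x) (c i) :=
    (heq i).isLocalMax (Ici_mem_nhds hi)
  have hd : HasDerivAt (fun x : ℝ => V i (x + ∑ j ∈ univ.erase i, c j) - x)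
      (deriv (V i) F - 1) (c i) := by
    have h1 : HasDerivAt (V i) (deriv (V i) F) (c i + ∑ j ∈ univ.erase i, c j) := by
      rw [hsum]; exact (hV i F).hasDerivAt
    exact (h1.comp_add_const (c i) _).sub (hasDerivAt_id (c i))
  have h1 : deriv (V i) F - 1 = 0 := hloc.hasDerivAt_eq_zero hd
  have h2 : deriv (V j) F ≤ ∑ k ∈ univ.erase i, deriv (V k) F :=
    Finset.single_le_sum (f := fun k => deriv (V k) F) (fun k _ => hnonneg k)
      (mem_erase.mpr ⟨hij, mem_univ j⟩)
  have h3 := Finset.add_sum_erase univ (fun k => deriv (V k) F) (mem_univ i)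
  linarith
end

section
/- Fix α ∈ [0, 1] and contributions c_1, …, c_N ≥ 0 with c_i > 0 for a given citizen i, and let S = Σ_j √c_j. The Capital-constrained Quadratic Finance funding F = α(Σ_j √c_j)² + (1 − α)Σ_j c_j is differentiable in c_i with ∂F/∂c_i = α·S/√c_i + (1 − α), and this marginal funding impact satisfies α·S/√c_i + (1 − α) ≥ 1, with strict inequality when α > 0 and some citizen j ≠ i has c_j > 0. Hence CQF is individually rational: a contribution through CQF has weakly greater marginal impact than a contribution through a purely private channel, whose marginal impact is 1. -/
open Finset

/-- Individual rationality of Capital-constrained Quadratic Finance: with weight `α ∈ [0,1]`,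
contributions `c j ≥ 0`, `c i > 0` and `S = ∑ j, √(c j)`, the CQF funding, viewed as a
function of citizen `i`'s contribution, is differentiable at `c i` with derivative
`α·S/√(c i) + (1 - α)`, and this marginal impact is at least `1` (the marginal impact of a
purely private contribution), strictly so when `α > 0` and some other citizen contributes a
positive amount. -/
theorem cqf_individually_rational (N : ℕ) (α : ℝ) (hα : α ∈ Set.Icc (0 : ℝ) 1)
    (c : Fin N → ℝ) (hc : ∀ j, 0 ≤ c j) (i : Fin N) (hci : 0 < c i)
    (S : ℝ) (hS : S = ∑ j, Real.sqrt (c j)) :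
    HasDerivAt (fun x : ℝ =>
        α * (Real.sqrt x + ∑ j ∈ univ.erase i, Real.sqrt (c j)) ^ 2 +
          (1 - α) * (x + ∑ j ∈ univ.erase i, c j))
      (α * S / Real.sqrt (c i) + (1 - α)) (c i) ∧
    1 ≤ α * S / Real.sqrt (c i) + (1 - α) ∧
    (0 < α → (∃ j, j ≠ i ∧ 0 < c j) → 1 < α * S / Real.sqrt (c i) + (1 - α)) := by
  have hs : 0 < Real.sqrt (c i) := Real.sqrt_pos.mpr hci
  have hsplit : S = Real.sqrt (c i) + ∑ j ∈ univ.erase i, Real.sqrt (c j) := by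
    rw [hS, Finset.add_sum_erase _ (fun j => Real.sqrt (c j)) (mem_univ i)]
  have hT : 0 ≤ ∑ j ∈ univ.erase i, Real.sqrt (c j) :=
    Finset.sum_nonneg fun j _ => Real.sqrt_nonneg _
  have hval : α * S / Real.sqrt (c i) + (1 - α) =
      1 + α * (∑ j ∈ univ.erase i, Real.sqrt (c j)) / Real.sqrt (c i) := by
    rw [hsplit]
    field_simp
    ring
  refine ⟨?_, ?_, ?_⟩
  · have h1 := (((Real.hasDerivAt_sqrt hci.ne').add_const
      (∑ j ∈ univ.erase i, Real.sqrt (c j))).pow 2).const_mul α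
    have h2 := ((hasDerivAt_id (c i)).add_const (∑ j ∈ univ.erase i, c j)).const_mul (1 - α)
    refine (h1.add h2).congr_deriv ?_
    rw [hsplit]
    field_simp
    norm_num
    ring
  · rw [hval]
    have := div_nonneg (mul_nonneg hα.1 hT) hs.le
    linarith
  · rintro hpos ⟨j, hji, hj⟩
    rw [hval]
    have hT' : 0 < ∑ j ∈ univ.erase i, Real.sqrt (c j) :=
      Finset.sum_pos' (fun j _ => Real.sqrt_nonneg _)
        ⟨j, mem_erase.mpr ⟨hji, mem_univ j⟩, Real.sqrt_pos.mpr hj⟩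
    have := div_pos (mul_pos hpos hT') hs
    linarith
end

section
/- Fix α ∈ (0, 1], contributions c_1, …, c_N > 0, S = Σ_j √c_j, and differentiable V_1, …, V_N : ℝ → ℝ. If for every citizen i the CQF first-order condition V_i'(F) = √c_i / (α·S + (1 − α)√c_i) holds at the funding level F, then 1 ≤ Σ_i V_i'(F) ≤ 1/α. In particular, equilibrium funding under CQF leaves aggregate marginal value between 1 (the optimum) and 1/α, so underfunding is at most a factor 1/α on the margin. -/
open Finset

/-- Bounded underfunding under Capital-constrained Quadratic Finance: with weight
`α ∈ (0, 1]`, positive contributions, `S = ∑ j, √(c j)` and funding level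
`F = α S² + (1 - α) ∑ j, c j`, if every citizen's CQF first-order condition
`(V i)' F = √(c i) / (α S + (1 - α) √(c i))` holds, then the aggregate marginal value lies
between `1` (the optimum) and `1/α`. -/
theorem cqf_bounded_underfunding (N : ℕ) (hN : 0 < N) (α : ℝ) (hα : α ∈ Set.Ioc (0 : ℝ) 1)
    (c : Fin N → ℝ) (hc : ∀ i, 0 < c i) (S F : ℝ) (hS : S = ∑ j, Real.sqrt (c j))
    (hF : F = α * S ^ 2 + (1 - α) * ∑ j, c j)
    (V : Fin N → ℝ → ℝ) (hV : ∀ i, Differentiable ℝ (V i))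
    (hfoc : ∀ i, deriv (V i) F = Real.sqrt (c i) / (α * S + (1 - α) * Real.sqrt (c i))) :
    1 ≤ ∑ i, deriv (V i) F ∧ ∑ i, deriv (V i) F ≤ 1 / α := by
  obtain ⟨h0, h1⟩ := hα
  have hpos : ∀ i, 0 < Real.sqrt (c i) := fun i => Real.sqrt_pos.mpr (hc i)
  have hle : ∀ i, Real.sqrt (c i) ≤ S := by
    intro i
    rw [hS]
    exact Finset.single_le_sum (f := fun j => Real.sqrt (c j))
      (fun j _ => (hpos j).le) (Finset.mem_univ i)
  have hSpos : 0 < S := lt_of_lt_of_le (hpos ⟨0, hN⟩) (hle ⟨0, hN⟩)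
  have hsum : ∑ i, Real.sqrt (c i) / S = 1 := by
    rw [← Finset.sum_div, ← hS, div_self hSpos.ne']
  have hαS : 0 < α * S := mul_pos h0 hSpos
  have hnn : ∀ i, 0 ≤ (1 - α) * Real.sqrt (c i) := fun i =>
    mul_nonneg (by linarith) (hpos i).le
  constructor
  · rw [← hsum]
    refine Finset.sum_le_sum fun i _ => ?_
    rw [hfoc i]
    refine div_le_div_of_nonneg_left (hpos i).le (by linarith [hnn i]) ?_
    nlinarith [mul_le_mul_of_nonneg_left (hle i) (sub_nonneg.mpr h1)]
  · have h2 : ∑ i, Real.sqrt (c i) / (α * S) = 1 / α := by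
      rw [← Finset.sum_div, ← hS]
      field_simp
    rw [← h2]
    refine Finset.sum_le_sum fun i _ => ?_
    rw [hfoc i]
    exact div_le_div_of_nonneg_left (hpos i).le hαS (by linarith [hnn i])
end

section
/- Fix β with 1 < β < 2 and contributions c_1, …, c_N ≥ 0 of which at least two are strictly positive, and let F = (Σ_j c_j^{1/β})^β. Let V_1, …, V_N : ℝ → ℝ be differentiable. If for every citizen i the first-order condition V_i'(F) = c_i^{(β−1)/β} / (Σ_j c_j^{1/β})^{β−1} holds, then Σ_i V_i'(F) > 1; that is, every β-power rule strictly between private contributions and Quadratic Finance underfunds goods with multiple contributors on the margin. -/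
open Finset

/-- The β-power rule with the given range of β, applied to nonnegative contributions of which
at least two are strictly positive, with funding `F = (∑ j, (c j)^(1/β))^β`: if every
citizen's first-order condition holds, the rule underfunds (`∑ i, (V i)' F > 1`)
goods with multiple contributors on the margin. -/
theorem beta_rule_underfunds (N : ℕ) (β : ℝ) (hβ1 : 1 < β) (hβ2 : β < 2)
    (c : Fin N → ℝ) (hc : ∀ i, 0 ≤ c i)
    (i₁ i₂ : Fin N) (hne : i₁ ≠ i₂) (h₁ : 0 < c i₁) (h₂ : 0 < c i₂)
    (F : ℝ) (hF : F = (∑ j, (c j) ^ (1 / β)) ^ β)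
    (V : Fin N → ℝ → ℝ) (hV : ∀ i, Differentiable ℝ (V i))
    (hfoc : ∀ i, deriv (V i) F =
      (c i) ^ ((β - 1) / β) / (∑ j, (c j) ^ (1 / β)) ^ (β - 1)) :
    1 < ∑ i, deriv (V i) F := by
  set S := ∑ j, (c j) ^ (1 / β) with hS
  have hx : ∀ j, 0 ≤ (c j) ^ (1 / β) := fun j => Real.rpow_nonneg (hc j) _
  have p1 : 0 < (c i₁) ^ (1 / β) := Real.rpow_pos_of_pos h₁ _
  have p2 : 0 < (c i₂) ^ (1 / β) := Real.rpow_pos_of_pos h₂ _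
  have hle : ∀ j, (c j) ^ (1 / β) ≤ S := fun j =>
    Finset.single_le_sum (f := fun j => (c j) ^ (1 / β)) (fun i _ => hx i) (Finset.mem_univ j)
  have hSpos : 0 < S := lt_of_lt_of_le p1 (hle i₁)
  have hlt : (c i₁) ^ (1 / β) < S :=
    Finset.single_lt_sum (f := fun j => (c j) ^ (1 / β)) hne.symm (Finset.mem_univ i₁)
      (Finset.mem_univ i₂) p2 (fun k _ _ => hx k)
  have key : ∀ i, deriv (V i) F = ((c i) ^ (1 / β) / S) ^ (β - 1) := by
    intro i
    rw [hfoc i, Real.div_rpow (hx i) hSpos.le, ← Real.rpow_mul (hc i)]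
    congr 2
    ring
  have hsum : ∑ i, (c i) ^ (1 / β) / S = 1 := by
    rw [← Finset.sum_div, ← hS, div_self hSpos.ne']
  rw [← hsum]
  apply Finset.sum_lt_sum
  · intro i _
    rw [key i]
    rcases (div_nonneg (hx i) hSpos.le).eq_or_lt with h | h
    · rw [← h]
      exact Real.rpow_nonneg le_rfl _
    · have := Real.rpow_le_rpow_of_exponent_ge h ((div_le_one hSpos).2 (hle i))
        (show β - 1 ≤ 1 by linarith)
      rwa [Real.rpow_one] at this
  · refine ⟨i₁, Finset.mem_univ _, ?_⟩
    rw [key i₁]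
    have := Real.rpow_lt_rpow_of_exponent_gt (div_pos p1 hSpos) ((div_lt_one hSpos).2 hlt)
      (show β - 1 < 1 by linarith)
    rwa [Real.rpow_one] at this
end

section
/- Fix β > 2 and contributions c_1, …, c_N ≥ 0 of which at least two are strictly positive, and let F = (Σ_j c_j^{1/β})^β. Let V_1, …, V_N : ℝ → ℝ be differentiable. If for every citizen i the first-order condition V_i'(F) = c_i^{(β−1)/β} / (Σ_j c_j^{1/β})^{β−1} holds, then Σ_i V_i'(F) < 1; that is, every β-power rule with β > 2 overfunds goods with multiple contributors on the margin. -/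
open Finset

/-- The β-power rule with the given range of β, applied to nonnegative contributions of which
at least two are strictly positive, with funding `F = (∑ j, (c j)^(1/β))^β`: if every
citizen's first-order condition holds, the rule overfunds (`∑ i, (V i)' F < 1`)
goods with multiple contributors on the margin. -/
theorem beta_rule_overfunds (N : ℕ) (β : ℝ) (hβ : 2 < β)
    (c : Fin N → ℝ) (hc : ∀ i, 0 ≤ c i)
    (i₁ i₂ : Fin N) (hne : i₁ ≠ i₂) (h₁ : 0 < c i₁) (h₂ : 0 < c i₂)
    (F : ℝ) (hF : F = (∑ j, (c j) ^ (1 / β)) ^ β)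
    (V : Fin N → ℝ → ℝ) (hV : ∀ i, Differentiable ℝ (V i))
    (hfoc : ∀ i, deriv (V i) F =
      (c i) ^ ((β - 1) / β) / (∑ j, (c j) ^ (1 / β)) ^ (β - 1)) :
    ∑ i, deriv (V i) F < 1 := by
  have hs0 : ∀ i, 0 ≤ (c i) ^ (1 / β) := fun i => Real.rpow_nonneg (hc i) _
  have hp₁ : 0 < (c i₁) ^ (1 / β) := Real.rpow_pos_of_pos h₁ _
  have hp₂ : 0 < (c i₂) ^ (1 / β) := Real.rpow_pos_of_pos h₂ _
  have hle : ∀ i, (c i) ^ (1 / β) ≤ ∑ j, (c j) ^ (1 / β) := fun i =>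
    Finset.single_le_sum (f := fun j => (c j) ^ (1 / β)) (fun j _ => hs0 j) (Finset.mem_univ i)
  have hlt : (c i₁) ^ (1 / β) < ∑ j, (c j) ^ (1 / β) :=
    Finset.single_lt_sum (f := fun j => (c j) ^ (1 / β)) hne.symm (Finset.mem_univ i₁)
      (Finset.mem_univ i₂) hp₂ (fun j _ _ => hs0 j)
  have hterm : ∀ i, deriv (V i) F =
      ((c i) ^ (1 / β) / ∑ j, (c j) ^ (1 / β)) ^ (β - 1) := by
    intro i
    rw [hfoc i, Real.div_rpow (hs0 i) ((hs0 i).trans (hle i)), ← Real.rpow_mul (hc i)]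
    congr 2
    ring
  have hsum : ∑ i, (c i) ^ (1 / β) / ∑ j, (c j) ^ (1 / β) = 1 := by
    rw [← Finset.sum_div]
    exact div_self (hp₁.trans hlt).ne'
  generalize (∑ j, (c j) ^ (1 / β)) = S at *
  have hS : 0 < S := hp₁.trans hlt
  rw [← hsum]
  apply Finset.sum_lt_sum
  · intro i _
    rw [hterm i]
    exact Real.rpow_le_self_of_le_one (div_nonneg (hs0 i) hS.le)
      ((div_le_one hS).2 (hle i)) (by linarith)
  · refine ⟨i₁, Finset.mem_univ _, ?_⟩
    rw [hterm i₁]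
    exact Real.rpow_lt_self_of_lt_one (div_pos hp₁ hS)
      ((div_lt_one hS).2 hlt) (by linarith)
end

section
/- Let k > 0 and let h : ℝ → ℝ be continuous on [0, ∞) with h(0) = 0, and suppose that for every x > 0, h(x) > 0 and h is differentiable at x with h'(x) = 1/(k·h(x)). Then h(x) = √(2x/k) for all x ≥ 0. (This is the uniqueness step in the derivation showing that the contribution-transformation in any funding rule satisfying the proportional-influence differential equation must be a square-root function, so that the rule is Quadratic Finance.) -/
/-- Uniqueness step in the axiomatic derivation of Quadratic Finance: if `k > 0` and
`h : ℝ → ℝ` is continuous on `[0, ∞)` with `h 0 = 0`, and for every `x > 0` we have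
`h x > 0` and `h` is differentiable at `x` with `h' x = 1 / (k · h x)`, then
`h x = √(2x/k)` for all `x ≥ 0`. -/
theorem qf_ode_uniqueness (k : ℝ) (hk : 0 < k) (h : ℝ → ℝ)
    (hcont : ContinuousOn h (Set.Ici 0)) (h0 : h 0 = 0)
    (hode : ∀ x : ℝ, 0 < x → 0 < h x ∧ HasDerivAt h (1 / (k * h x)) x) :
    ∀ x : ℝ, 0 ≤ x → h x = Real.sqrt (2 * x / k) := by
  intro x hx
  rcases hx.eq_or_lt with rfl | hx
  · simp [h0]
  have hc : ContinuousOn (fun y => h y ^ 2) (Set.Icc 0 x) :=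
    (hcont.mono Set.Icc_subset_Ici_self).pow 2
  have hd : ∀ y ∈ Set.Ioo 0 x, HasDerivAt (fun y => h y ^ 2) ((fun _ => 2 / k) y) y := by
    intro y hy
    obtain ⟨hp, hdy⟩ := hode y hy.1
    have hne := hp.ne'
    have hkne := hk.ne'
    refine (hdy.fun_pow 2).congr_deriv ?_
    simp
    field_simp
  obtain ⟨c, -, hs⟩ := exists_hasDerivAt_eq_slope (fun y => h y ^ 2) (fun _ => 2 / k) hx hc hd
  have hsq : 2 * x / k = h x ^ 2 := by
    simp only [h0] at hs
    rw [eq_div_iff (by linarith)] at hs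
    have e : 2 * x / k = 2 / k * (x - 0) := by ring
    rw [e, hs]
    ring
  rw [hsq, Real.sqrt_sq (hode x hx).1.le]
end
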